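/- Let M1, M2 ∈ ℝ^{d1×d2} be rank-r matrices with SVDs M1 = L1Σ1R1ᵀ and M2 = L2Σ2R2ᵀ. If ‖M1 − M2‖_op ≤ (1/2)·σ_r(M1), then the squared rotation-invariant distance between the balanced factorizations satisfies d²(L2Σ2^{1/2}, R2Σ2^{1/2}; L1Σ1^{1/2}, R1Σ1^{1/2}) ≤ (2/(√2−1))·‖M2 − M1‖_F²/σ_r(M1), where d(U,V;U*,V*) = min over orthogonal Q ∈ O(r) of √(‖U − U*Q‖_F² + ‖V − V*Q‖_F²). -/

import Mathlib

open Matrix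
open scoped BigOperators

/-- Frobenius norm of a real matrix. -/
noncomputable def frob {m n : ℕ} (A : Matrix (Fin m) (Fin n) ℝ) : ℝ :=
  Real.sqrt (∑ i, ∑ j, (A i j) ^ 2)

/-- Operator (spectral) norm of a real matrix. -/
noncomputable def opNorm {m n : ℕ} (A : Matrix (Fin m) (Fin n) ℝ) : ℝ :=
  ‖LinearMap.toContinuousLinearMap (Matrix.toEuclideanLin A)‖

/-- Maximum absolute entry of a matrix. -/
noncomputable def entrySup {m n : ℕ} (A : Matrix (Fin m) (Fin n) ℝ) : ℝ :=
  ⨆ i, ⨆ j, |A i j|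

/-- ℓ2 norm of the i-th row of a matrix. -/
noncomputable def rowNorm {m n : ℕ} (A : Matrix (Fin m) (Fin n) ℝ) (i : Fin m) : ℝ :=
  Real.sqrt (∑ j, (A i j) ^ 2)

/-- The (2,∞) norm: maximum ℓ2 norm of the rows. -/
noncomputable def twoInf {m n : ℕ} (A : Matrix (Fin m) (Fin n) ℝ) : ℝ :=
  ⨆ i, rowNorm A i

theorem frob_sq {m n : ℕ} (A : Matrix (Fin m) (Fin n) ℝ) : frob A ^ 2 = (Aᵀ * A).trace := by
  rw [frob, Real.sq_sqrt (by positivity), Finset.sum_comm]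
  simp [Matrix.trace, Matrix.mul_apply, sq]

/-- A square matrix whose columns are pairwise orthogonal is an orthogonal matrix times a
nonnegative diagonal matrix. -/
theorem exists_orthogonal_transpose_mul_eq_diagonal {n : Type*} [Fintype n] [DecidableEq n]
    (F : Matrix n n ℝ) (hF : (Fᵀ * F).IsDiag) :
    ∃ (W : Matrix n n ℝ) (d : n → ℝ), Wᵀ * W = 1 ∧ 0 ≤ d ∧ Wᵀ * F = diagonal d := by
  let e := Fintype.equivFin n
  let f : Fin (Fintype.card n) → EuclideanSpace ℝ n := fun i => WithLp.toLp 2 (F.col (e.symm i))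
  have hcard : Module.finrank ℝ (EuclideanSpace ℝ n) = Fintype.card (Fin (Fintype.card n)) := by
    simp
  have hinner (i j : Fin (Fintype.card n)) :
      inner ℝ (f i) (f j) = (Fᵀ * F) (e.symm i) (e.symm j) := by
    simp [f, PiLp.inner_apply, Matrix.mul_apply, mul_comm]
  have horth : Pairwise fun i j => inner ℝ (f i) (f j) = 0 := fun i j hij => by
    change inner ℝ (f i) (f j) = 0
    rw [hinner]
    exact hF (e.symm.injective.ne hij)
  let w := InnerProductSpace.gramSchmidtOrthonormalBasis hcard f
  have hw (j : Fin (Fintype.card n)) : f j = ‖f j‖ • w j := by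
    by_cases h : f j = 0
    · simp [h]
    · have := InnerProductSpace.gramSchmidtOrthonormalBasis_apply_of_orthogonal hcard horth h
      simp only [w, this]
      simp [smul_smul, h]
  refine ⟨Matrix.of fun i j => w (e j) i, fun j => ‖f (e j)‖, ?_, fun j => norm_nonneg _, ?_⟩
  · ext i j
    have h := orthonormal_iff_ite.mp w.orthonormal (e i) (e j)
    rw [PiLp.inner_apply] at h
    simpa [Matrix.mul_apply, Matrix.one_apply, mul_comm] using h
  · ext i j
    have h := orthonormal_iff_ite.mp w.orthonormal (e i) (e j)
    have h' : inner ℝ (w (e i)) (f (e j)) = if i = j then ‖f (e j)‖ else 0 := by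
      rw [hw (e j), inner_smul_right, h]
      simp [norm_smul]
    rw [PiLp.inner_apply] at h'
    rw [Matrix.diagonal_apply, Matrix.mul_apply]
    have hij : (if i = j then ‖f (e i)‖ else 0) = if i = j then ‖f (e j)‖ else 0 := by
      split_ifs with hh
      · rw [hh]
      · rfl
    rw [hij, ← h']
    simp [f, mul_comm]

/-- Polar decomposition of a square real matrix. -/
theorem exists_orthogonal_transpose_mul_posSemidef {n : Type*} [Fintype n] [DecidableEq n]
    (B : Matrix n n ℝ) : ∃ Q : Matrix n n ℝ, Qᵀ * Q = 1 ∧ (Qᵀ * B).PosSemidef := by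
  have hB : (Bᵀ * B).IsHermitian := by simp [IsHermitian, conjTranspose_eq_transpose_of_trivial]
  let V : Matrix n n ℝ := hB.eigenvectorUnitary
  have hV : Vᵀ * V = 1 := by
    simpa [V, star_eq_conjTranspose, conjTranspose_eq_transpose_of_trivial] using
      Unitary.coe_star_mul_self hB.eigenvectorUnitary
  have hV' : V * Vᵀ = 1 := mul_eq_one_comm.mp hV
  have hspec : Vᵀ * (Bᵀ * B) * V = diagonal hB.eigenvalues := by
    have h := hB.conjStarAlgAut_star_eigenvectorUnitary
    rw [Unitary.conjStarAlgAut_apply] at h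
    simpa [V, star_eq_conjTranspose, conjTranspose_eq_transpose_of_trivial, Function.comp_def]
      using h
  obtain ⟨W, d, hW, hd, hWF⟩ := exists_orthogonal_transpose_mul_eq_diagonal (B * V) (by
    rw [show (B * V)ᵀ * (B * V) = Vᵀ * (Bᵀ * B) * V by
      simp only [transpose_mul, Matrix.mul_assoc], hspec]
    exact isDiag_diagonal _)
  refine ⟨W * Vᵀ, ?_, ?_⟩
  · rw [transpose_mul, transpose_transpose, Matrix.mul_assoc, ← Matrix.mul_assoc Wᵀ, hW,
      Matrix.one_mul, hV']
  · have h : (W * Vᵀ)ᵀ * B = V * diagonal d * Vᴴ := by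
      rw [conjTranspose_eq_transpose_of_trivial, ← hWF, transpose_mul, transpose_transpose]
      simp only [Matrix.mul_assoc, hV', Matrix.mul_one]
    rw [h]
    exact (PosSemidef.diagonal hd).mul_mul_conjTranspose_same V

theorem trace_gram_mul_nonneg {m n : Type*} [Fintype m] [Fintype n] (H : Matrix m n ℝ)
    {P : Matrix n n ℝ} (hP : P.PosSemidef) : 0 ≤ (Hᵀ * H * P).trace := by
  have h := (hP.mul_mul_conjTranspose_same H).trace_nonneg
  rwa [conjTranspose_eq_transpose_of_trivial, trace_mul_cycle] at h

theorem trace_symm_sq_nonneg {n : Type*} [Fintype n] {A : Matrix n n ℝ} (hA : Aᵀ = A) :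
    0 ≤ (A * A).trace := by
  have h := (posSemidef_conjTranspose_mul_self A).trace_nonneg
  rwa [conjTranspose_eq_transpose_of_trivial, hA] at h

theorem gram_trace_identity {n : Type*} [Fintype n] (E K C : Matrix n n ℝ) (t : ℝ)
    (ht : t ^ 2 = 2) :
    ((E + (2 : ℝ) • C - K) * (E + (2 : ℝ) • C - K)).trace - 2 * (C * C).trace + (K * K).trace
      = ((E + t • (C - K)) * (E + t • (C - K))).trace + (4 - 2 * t) * (E * C).trace
        + (2 * t - 2) * (E * K).trace := by
  simp only [add_mul, mul_add, sub_mul, mul_sub, trace_add, trace_sub, smul_mul_assoc,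
    mul_smul_comm, trace_smul, smul_sub, smul_eq_mul]
  rw [trace_mul_comm C E, trace_mul_comm K E, trace_mul_comm K C]
  linear_combination (-(C * C).trace + 2 * (C * K).trace - (K * K).trace) * ht

theorem exists_orthogonal_mul_trace_sub_le {m n : Type*} [Fintype m] [Fintype n] [DecidableEq n]
    (X Z : Matrix m n ℝ) (s : ℝ) (hs : (Xᵀ * X - s • (1 : Matrix n n ℝ)).PosSemidef) :
    ∃ Q : Matrix n n ℝ, Qᵀ * Q = 1 ∧
      2 * (√2 - 1) * s * ((Z - X * Q)ᵀ * (Z - X * Q)).trace ≤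
        (Zᵀ * Z * (Zᵀ * Z)).trace - 2 * ((Xᵀ * Z)ᵀ * (Xᵀ * Z)).trace
          + (Xᵀ * X * (Xᵀ * X)).trace := by
  obtain ⟨Q, hQ, hC⟩ := exists_orthogonal_transpose_mul_posSemidef (Xᵀ * Z)
  have hQ' : Q * Qᵀ = 1 := mul_eq_one_comm.mp hQ
  refine ⟨Q, hQ, ?_⟩
  set C := Qᵀ * (Xᵀ * Z) with hCdef
  set H := Z - X * Q with hH
  set K := Qᵀ * (Xᵀ * X) * Q with hK
  have hCt : Cᵀ = C := by simpa [conjTranspose_eq_transpose_of_trivial] using hC.isHermitian.eq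
  have hKt : Kᵀ = K := by simp [hK, transpose_mul, Matrix.mul_assoc]
  have hG : Zᵀ * Z = Hᵀ * H + (2 : ℝ) • C - K := by
    have h1 : Zᵀ * (X * Q) = C := by
      rw [← hCt, hCdef]; simp [transpose_mul, Matrix.mul_assoc]
    have h2 : (X * Q)ᵀ * Z = C := by simp [hCdef, transpose_mul, Matrix.mul_assoc]
    have h3 : (X * Q)ᵀ * (X * Q) = K := by simp [hK, transpose_mul, Matrix.mul_assoc]
    rw [hH, transpose_sub, Matrix.sub_mul, Matrix.mul_sub, Matrix.mul_sub, h1, h2, h3, two_smul]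
    abel
  have hCC : ((Xᵀ * Z)ᵀ * (Xᵀ * Z)).trace = (C * C).trace := by
    nth_rewrite 1 [← hCt]
    rw [hCdef, transpose_mul Qᵀ, transpose_transpose, Matrix.mul_assoc _ Q, ← Matrix.mul_assoc Q,
      hQ', Matrix.one_mul]
  have hKK : (Xᵀ * X * (Xᵀ * X)).trace = (K * K).trace := by
    have h : K * K = Qᵀ * (Xᵀ * X * (Xᵀ * X)) * Q := by
      rw [hK]
      calc _ = Qᵀ * (Xᵀ * X) * (Q * Qᵀ) * (Xᵀ * X) * Q := by simp only [Matrix.mul_assoc]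
        _ = _ := by rw [hQ']; simp only [Matrix.mul_assoc, Matrix.one_mul]
    rw [h, trace_mul_cycle Qᵀ, hQ', Matrix.one_mul]
  have hEC := trace_gram_mul_nonneg H hC
  have hEK : s * (Hᵀ * H).trace ≤ (Hᵀ * H * K).trace := by
    have h := trace_gram_mul_nonneg H (hs.conjTranspose_mul_mul_same Q)
    have hQs : Qᴴ * (Xᵀ * X - s • 1) * Q = K - s • (1 : Matrix n n ℝ) := by
      rw [conjTranspose_eq_transpose_of_trivial, Matrix.mul_sub, Matrix.sub_mul, ← hK,
        Matrix.mul_smul, Matrix.smul_mul, Matrix.mul_one, hQ]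
    rw [hQs, Matrix.mul_sub, Matrix.mul_smul, Matrix.mul_one, trace_sub, trace_smul,
      smul_eq_mul] at h
    linarith
  have ht : √2 ^ 2 = 2 := Real.sq_sqrt (by norm_num)
  have hsymm := trace_symm_sq_nonneg (A := Hᵀ * H + √2 • (C - K)) (by
    simp [transpose_mul, hCt, hKt])
  have ht1 : 1 ≤ √2 := Real.one_le_sqrt.mpr (by norm_num)
  have ht2 : √2 ≤ 2 := by nlinarith
  rw [hG, hCC, hKK, gram_trace_identity _ _ _ _ ht]
  nlinarith [mul_le_mul_of_nonneg_left hEK (show 0 ≤ 2 * √2 - 2 by linarith),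
    mul_nonneg (show 0 ≤ 4 - 2 * √2 by linarith) hEC]

theorem trace_transpose_mul_self_svd {m n k : Type*} [Fintype m] [Fintype n] [Fintype k]
    [DecidableEq k] (L L' : Matrix m k ℝ) (R R' : Matrix n k ℝ) (a b : k → ℝ) :
    ((L * diagonal a * Rᵀ)ᵀ * (L' * diagonal b * R'ᵀ)).trace
      = ∑ i, ∑ j, a i * b j * ((Lᵀ * L') i j * (Rᵀ * R') i j) := by
  have h : ((L * diagonal a * Rᵀ)ᵀ * (L' * diagonal b * R'ᵀ)).trace
      = ((Rᵀ * R')ᵀ * (diagonal a * (Lᵀ * L') * diagonal b)).trace := by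
    have h' : (L * diagonal a * Rᵀ)ᵀ * (L' * diagonal b * R'ᵀ)
        = R * (diagonal a * (Lᵀ * L') * diagonal b) * R'ᵀ := by
      simp only [transpose_mul, transpose_transpose, diagonal_transpose, Matrix.mul_assoc]
    rw [h', trace_mul_cycle, transpose_mul, transpose_transpose]
  rw [h, Matrix.trace, Finset.sum_comm]
  refine Finset.sum_congr rfl fun j _ => ?_
  simp only [diag_apply, Matrix.mul_apply (M := (Rᵀ * R')ᵀ), mul_diagonal, diagonal_mul,
    transpose_apply (M := Rᵀ * R')]
  refine Finset.sum_congr rfl fun i _ => ?_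
  ring

theorem transpose_mul_diagonal_mul_mul_diagonal {m k : Type*} [Fintype m] [Fintype k]
    [DecidableEq k] (A A' : Matrix m k ℝ) (u v : k → ℝ) :
    (A * diagonal u)ᵀ * (A' * diagonal v) = diagonal u * (Aᵀ * A') * diagonal v := by
  simp only [transpose_mul, diagonal_transpose, Matrix.mul_assoc]

theorem gram_fromRows_mul_diagonal_sqrt {m n k : Type*} [Fintype m] [Fintype n] [Fintype k]
    [DecidableEq k] (L : Matrix m k ℝ) (R : Matrix n k ℝ) (a : k → ℝ) (hL : Lᵀ * L = 1)
    (hR : Rᵀ * R = 1) (ha : 0 ≤ a) :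
    (fromRows (L * diagonal fun i => √(a i)) (R * diagonal fun i => √(a i)))ᵀ
        * fromRows (L * diagonal fun i => √(a i)) (R * diagonal fun i => √(a i))
      = diagonal fun i => 2 * a i := by
  rw [transpose_fromRows, fromCols_mul_fromRows, transpose_mul_diagonal_mul_mul_diagonal,
    transpose_mul_diagonal_mul_mul_diagonal, hL, hR, Matrix.mul_one, diagonal_mul_diagonal,
    diagonal_add]
  simp only [Real.mul_self_sqrt (ha _), two_mul]

theorem trace_transpose_mul_self_sub_svd {m n k : Type*} [Fintype m] [Fintype n] [Fintype k]
    [DecidableEq k] (L L' : Matrix m k ℝ) (R R' : Matrix n k ℝ) (a b : k → ℝ)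
    (hL : Lᵀ * L = 1) (hR : Rᵀ * R = 1) (hL' : L'ᵀ * L' = 1) (hR' : R'ᵀ * R' = 1) :
    ((L' * diagonal b * R'ᵀ - L * diagonal a * Rᵀ)ᵀ
        * (L' * diagonal b * R'ᵀ - L * diagonal a * Rᵀ)).trace
      = ∑ i, b i ^ 2 + ∑ i, a i ^ 2
        - 2 * ∑ i, ∑ j, a i * b j * ((Lᵀ * L') i j * (Rᵀ * R') i j) := by
  have hcomm : ((L' * diagonal b * R'ᵀ)ᵀ * (L * diagonal a * Rᵀ)).trace
      = ((L * diagonal a * Rᵀ)ᵀ * (L' * diagonal b * R'ᵀ)).trace := by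
    rw [← trace_transpose, transpose_mul, transpose_transpose]
  rw [transpose_sub, Matrix.sub_mul, Matrix.mul_sub, Matrix.mul_sub, trace_sub, trace_sub,
    trace_sub, hcomm]
  simp only [trace_transpose_mul_self_svd, hL, hR, hL', hR', one_apply]
  simp only [mul_ite, mul_one, mul_zero, Finset.sum_ite_eq, Finset.mem_univ, if_true, sq]
  ring

theorem trace_gram_cross {m n k : Type*} [Fintype m] [Fintype n] [Fintype k]
    [DecidableEq k] (L L' : Matrix m k ℝ) (R R' : Matrix n k ℝ) (a b : k → ℝ)
    (ha : 0 ≤ a) (hb : 0 ≤ b) :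
    let M := (fromRows (L * diagonal fun i => √(a i)) (R * diagonal fun i => √(a i)))ᵀ
        * fromRows (L' * diagonal fun i => √(b i)) (R' * diagonal fun i => √(b i))
    (Mᵀ * M).trace = ∑ i, ∑ j, a i * b j * ((Lᵀ * L') i j + (Rᵀ * R') i j) ^ 2 := by
  intro M
  have hM (i j : k) : M i j = √(a i) * √(b j) * ((Lᵀ * L') i j + (Rᵀ * R') i j) := by
    simp only [M, transpose_fromRows, fromCols_mul_fromRows, Matrix.add_apply,
      transpose_mul_diagonal_mul_mul_diagonal, mul_diagonal, diagonal_mul]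
    ring
  rw [Matrix.trace, Finset.sum_comm]
  refine Finset.sum_congr rfl fun j _ => ?_
  rw [diag_apply, Matrix.mul_apply]
  refine Finset.sum_congr rfl fun i _ => ?_
  rw [transpose_apply, hM, ← Real.sq_sqrt (ha i), ← Real.sq_sqrt (hb j),
    Real.sqrt_sq (Real.sqrt_nonneg _), Real.sqrt_sq (Real.sqrt_nonneg _)]
  ring

theorem of_sqrt_eq_diagonal {k : Type*} [DecidableEq k] (a : k → ℝ) :
    Matrix.of (fun i j => √(diagonal a i j)) = diagonal fun i => √(a i) := by
  ext i j
  by_cases h : i = j <;> simp [diagonal_apply, h]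

theorem stmt15 {d1 d2 r : ℕ} (σr : ℝ) (hσr : 0 < σr)
    (L1 L2 : Matrix (Fin d1) (Fin r) ℝ) (S1 S2 : Matrix (Fin r) (Fin r) ℝ)
    (R1 R2 : Matrix (Fin d2) (Fin r) ℝ)
    (hL1 : L1ᵀ * L1 = 1) (hR1 : R1ᵀ * R1 = 1)
    (hL2 : L2ᵀ * L2 = 1) (hR2 : R2ᵀ * R2 = 1)
    (hS1 : S1.IsDiag) (hS2 : S2.IsDiag)
    (hS1low : ∀ k : Fin r, σr ≤ S1 k k) (hS1min : ∃ k : Fin r, S1 k k = σr)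
    (hS2pos : ∀ k : Fin r, 0 ≤ S2 k k)
    (hop : opNorm (L1 * S1 * R1ᵀ - L2 * S2 * R2ᵀ) ≤ σr / 2) :
    sInf {x : ℝ | ∃ Q : Matrix (Fin r) (Fin r) ℝ, Qᵀ * Q = 1 ∧
        x = frob (L2 * Matrix.of (fun i j => Real.sqrt (S2 i j))
                  - L1 * Matrix.of (fun i j => Real.sqrt (S1 i j)) * Q) ^ 2
          + frob (R2 * Matrix.of (fun i j => Real.sqrt (S2 i j))
                  - R1 * Matrix.of (fun i j => Real.sqrt (S1 i j)) * Q) ^ 2}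
      ≤ (2 / (Real.sqrt 2 - 1))
          * frob (L2 * S2 * R2ᵀ - L1 * S1 * R1ᵀ) ^ 2 / σr := by
  obtain ⟨a, rfl⟩ : ∃ a, diagonal a = S1 := ⟨_, hS1.diagonal_diag⟩
  obtain ⟨b, rfl⟩ : ∃ b, diagonal b = S2 := ⟨_, hS2.diagonal_diag⟩
  simp only [diagonal_apply_eq] at hS1low hS2pos
  have ha : 0 ≤ a := fun i => hσr.le.trans (hS1low i)
  simp only [of_sqrt_eq_diagonal]
  set X := fromRows (L1 * diagonal fun i => √(a i)) (R1 * diagonal fun i => √(a i)) with hX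
  set Z := fromRows (L2 * diagonal fun i => √(b i)) (R2 * diagonal fun i => √(b i)) with hZ
  have hXX : Xᵀ * X = diagonal fun i => 2 * a i :=
    gram_fromRows_mul_diagonal_sqrt L1 R1 a hL1 hR1 ha
  have hZZ : Zᵀ * Z = diagonal fun i => 2 * b i :=
    gram_fromRows_mul_diagonal_sqrt L2 R2 b hL2 hR2 hS2pos
  have hXZ : ((Xᵀ * Z)ᵀ * (Xᵀ * Z)).trace
      = ∑ i, ∑ j, a i * b j * ((L1ᵀ * L2) i j + (R1ᵀ * R2) i j) ^ 2 :=
    trace_gram_cross L1 L2 R1 R2 a b ha hS2pos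
  obtain ⟨Q, hQ, hle⟩ := exists_orthogonal_mul_trace_sub_le X Z (2 * σr) (by
    rw [hXX, smul_one_eq_diagonal, diagonal_sub]
    exact PosSemidef.diagonal fun i => by
      have := hS1low i
      simp only [Pi.zero_apply]
      linarith)
  have hdist : ((Z - X * Q)ᵀ * (Z - X * Q)).trace
      = frob (L2 * (diagonal fun i => √(b i)) - L1 * (diagonal fun i => √(a i)) * Q) ^ 2
        + frob (R2 * (diagonal fun i => √(b i)) - R1 * (diagonal fun i => √(a i)) * Q) ^ 2 := by
    have h : Z - X * Q
        = fromRows (L2 * (diagonal fun i => √(b i)) - L1 * (diagonal fun i => √(a i)) * Q)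
          (R2 * (diagonal fun i => √(b i)) - R1 * (diagonal fun i => √(a i)) * Q) := by
      rw [hX, hZ, fromRows_mul]
      ext (i | i) j <;> rfl
    rw [h, transpose_fromRows, fromCols_mul_fromRows, trace_add, frob_sq, frob_sq]
  have hfrob := trace_transpose_mul_self_sub_svd L1 L2 R1 R2 a b hL1 hR1 hL2 hR2
  rw [← frob_sq] at hfrob
  have hcross : 4 * ∑ i, ∑ j, a i * b j * ((L1ᵀ * L2) i j * (R1ᵀ * R2) i j)
      ≤ ∑ i, ∑ j, a i * b j * ((L1ᵀ * L2) i j + (R1ᵀ * R2) i j) ^ 2 := by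
    simp only [Finset.mul_sum]
    refine Finset.sum_le_sum fun i _ => Finset.sum_le_sum fun j _ => ?_
    nlinarith [mul_nonneg (mul_nonneg (ha i) (hS2pos j))
      (sq_nonneg ((L1ᵀ * L2) i j - (R1ᵀ * R2) i j))]
  have hsq (c : Fin r → ℝ) :
      ((diagonal fun i => 2 * c i) * diagonal fun i => 2 * c i).trace = 4 * ∑ i, c i ^ 2 := by
    rw [diagonal_mul_diagonal, trace_diagonal, Finset.mul_sum]
    exact Finset.sum_congr rfl fun i _ => by ring
  rw [hXZ, hXX, hZZ, hsq, hsq] at hle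
  have ht : 0 < √2 - 1 := sub_pos.mpr (Real.lt_sqrt_of_sq_lt (by norm_num))
  refine csInf_le_of_le ⟨0, by rintro _ ⟨_, _, rfl⟩; positivity⟩
    (Exists.intro Q ⟨hQ, hdist⟩) ?_
  rw [div_mul_eq_mul_div, div_div, le_div_iff₀ (mul_pos ht hσr)]
  nlinarith [sq_nonneg (frob (L2 * diagonal b * R2ᵀ - L1 * diagonal a * R1ᵀ))]
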